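/- arXiv:2408.12927 — 2 statements merged into one kernel-verified Lean document; each statement's English description precedes it below -/
import Mathlib

section
/- Let R be a partial rank matrix and let w and c be two distinct candidates. For any scoring rule with weight vector (w_1,…,w_m), there exists a complete extension R'' of R such that simultaneously σ_{R''}(w) = σmin_R(w) and σ_{R''}(c) = σmax_R(c). -/
section Defs

variable {n m : ℕ} {C : Type*}

/-- A partial row (partial ballot): each candidate appears at most once. -/
def IsPartialRow (r : Fin m → Option C) : Prop :=
  ∀ ⦃k k' : Fin m⦄ ⦃c : C⦄, r k = some c → r k' = some c → k = k'

/-- `q` is a completion of the partial row `r` (a bijection from positions to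
candidates agreeing with `r` on all non-null entries). -/
def IsCompletion (r : Fin m → Option C) (q : Fin m ≃ C) : Prop :=
  ∀ ⦃k : Fin m⦄ ⦃c : C⦄, r k = some c → q k = c

/-- Number of non-null (locked) entries of a partial row. -/
def rowSize (r : Fin m → Option C) : ℕ :=
  (Finset.univ.filter fun k : Fin m => (r k).isSome).card

/-- A partial rank matrix: each candidate appears at most once in every row. -/
def IsPartialMat (R : Fin n → Fin m → Option C) : Prop :=
  ∀ i, IsPartialRow (R i)

/-- `Q` is a complete extension of the partial rank matrix `R`:
each row of `Q` is a bijection from positions to candidates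
agreeing with the corresponding row of `R` on all non-null entries. -/
def IsMatCompletion (R : Fin n → Fin m → Option C) (Q : Fin n → Fin m ≃ C) : Prop :=
  ∀ i, IsCompletion (R i) (Q i)

/-- Number of non-null (locked) entries of a partial rank matrix. -/
def matSize (R : Fin n → Fin m → Option C) : ℕ := ∑ i, rowSize (R i)

/-- `R ⊆ R'` : the partial rank matrix `R'` extends the partial rank matrix `R`. -/
def PExt (R R' : Fin n → Fin m → Option C) : Prop :=
  ∀ i k c, R i k = some c → R' i k = some c

/-- `w` is a necessary winner of the partial rank matrix `X` under voting rule `F`. -/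
def NecessaryWinner (F : (Fin n → Fin m ≃ C) → Set C)
    (X : Fin n → Fin m → Option C) (w : C) : Prop :=
  ∀ Q : Fin n → Fin m ≃ C, IsMatCompletion X Q → w ∈ F Q

/-- `R∖Y` : the partial rank matrix obtained from the complete rank matrix `R` by
erasing (making null) the entries locked in `Y`. -/
def matDiff (R : Fin n → Fin m ≃ C) (Y : Fin n → Fin m → Option C) :
    Fin n → Fin m → Option C :=
  fun i k => if (Y i k).isSome then none else some (R i k)

/-- Borda score of candidate `c` in the complete row `q` :
a candidate in position `k+1` (index `k`) scores `m - (k+1)`. -/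
def bordaRowScore (q : Fin m ≃ C) (c : C) : ℤ := (m : ℤ) - 1 - ((q.symm c : ℕ) : ℤ)

/-- Minimal Borda score of `c` over all completions of the partial row `r`. -/
noncomputable def rowSMin (r : Fin m → Option C) (c : C) : ℤ :=
  sInf {x : ℤ | ∃ q : Fin m ≃ C, IsCompletion r q ∧ bordaRowScore q c = x}

/-- Maximal Borda score of `c` over all completions of the partial row `r`. -/
noncomputable def rowSMax (r : Fin m → Option C) (c : C) : ℤ :=
  sSup {x : ℤ | ∃ q : Fin m ≃ C, IsCompletion r q ∧ bordaRowScore q c = x}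

/-- Total score margin `Δ(r) = Σ_{c' ≠ w} (σmin_r(w) − σmax_r(c'))` of `w` in the
partial row `r`, under Borda weights. -/
noncomputable def rowDelta [Fintype C] [DecidableEq C]
    (r : Fin m → Option C) (w : C) : ℤ :=
  ∑ c ∈ Finset.univ.filter (fun c : C => c ≠ w), (rowSMin r w - rowSMax r c)

/-- Borda score of candidate `c` in the complete rank matrix `Q`. -/
def bordaScore (Q : Fin n → Fin m ≃ C) (c : C) : ℤ := ∑ i, bordaRowScore (Q i) c

/-- `w ∈ Borda(Q)` : `w` has maximal Borda score in the complete rank matrix `Q`. -/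
def IsBordaWinner (Q : Fin n → Fin m ≃ C) (w : C) : Prop :=
  ∀ c, bordaScore Q c ≤ bordaScore Q w

/-- Score of candidate `c` in the complete rank matrix `Q` under the scoring rule
with weight vector `wt`. -/
def scoreW (wt : Fin m → ℝ) (Q : Fin n → Fin m ≃ C) (c : C) : ℝ :=
  ∑ i, wt ((Q i).symm c)

/-- `σmin_R(c)` : minimal score of `c` over all complete extensions of `R`. -/
noncomputable def matSMinW (wt : Fin m → ℝ) (R : Fin n → Fin m → Option C) (c : C) : ℝ :=
  sInf {x : ℝ | ∃ Q : Fin n → Fin m ≃ C, IsMatCompletion R Q ∧ scoreW wt Q c = x}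

/-- `σmax_R(c)` : maximal score of `c` over all complete extensions of `R`. -/
noncomputable def matSMaxW (wt : Fin m → ℝ) (R : Fin n → Fin m → Option C) (c : C) : ℝ :=
  sSup {x : ℝ | ∃ Q : Fin n → Fin m ≃ C, IsMatCompletion R Q ∧ scoreW wt Q c = x}

/-- `σmin_{R_i}(c)` : minimal score of `c` over all completions of the single row `r`. -/
noncomputable def rowSMinW (wt : Fin m → ℝ) (r : Fin m → Option C) (c : C) : ℝ :=
  sInf {x : ℝ | ∃ q : Fin m ≃ C, IsCompletion r q ∧ wt (q.symm c) = x}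

/-- `σmax_{R_i}(c)` : maximal score of `c` over all completions of the single row `r`. -/
noncomputable def rowSMaxW (wt : Fin m → ℝ) (r : Fin m → Option C) (c : C) : ℝ :=
  sSup {x : ℝ | ∃ q : Fin m ≃ C, IsCompletion r q ∧ wt (q.symm c) = x}

/-- `r` is in normal form of parameters `k1, k2`: a position `p = k+1` is null
exactly when `k1 < p < m + 1 - k2`. -/
def IsNormalForm (r : Fin m → Option C) (k1 k2 : ℕ) : Prop :=
  ∀ k : Fin m, r k = none ↔ (k1 < (k : ℕ) + 1 ∧ (k : ℕ) + 1 < m + 1 - k2)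

end Defs

theorem IsPartialRow.exists_isCompletion {m : ℕ} {C : Type*} [Fintype C] [Nonempty C]
    (hC : Fintype.card C = m) {r : Fin m → Option C} (hr : IsPartialRow r) :
    ∃ q : Fin m ≃ C, IsCompletion r q := by
  classical
  obtain ⟨w⟩ := ‹Nonempty C›
  have hinj : Set.InjOn (fun k => (r k).getD w)
      (Finset.univ.filter fun k : Fin m => (r k).isSome) := by
    intro k hk k' hk' h
    simp only [Finset.coe_filter, Finset.mem_univ, true_and, Set.mem_ofPred_eq,
      Option.isSome_iff_exists] at hk hk'
    obtain ⟨a, ha⟩ := hk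
    obtain ⟨b, hb⟩ := hk'
    simp only [ha, hb, Option.getD_some] at h
    exact hr ha (h ▸ hb)
  obtain ⟨g, hg⟩ := Finset.exists_equiv_extend_of_card_eq (t := (Finset.univ : Finset C))
    (by simp [hC]) (Finset.subset_univ _) hinj
  refine ⟨g.trans (Equiv.subtypeUnivEquiv Finset.mem_univ), fun k a hk => ?_⟩
  simpa [hk] using hg k (by simp [hk])

theorem IsCompletion.swap_trans {m : ℕ} {C : Type*} {r : Fin m → Option C}
    {q : Fin m ≃ C} (hq : IsCompletion r q) {p p' : Fin m} (hp : r p = none)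
    (hp' : r p' = none) : IsCompletion r ((Equiv.swap p p').trans q) := by
  intro k a hk
  have h : k ≠ p := by rintro rfl; simp [hp] at hk
  have h' : k ≠ p' := by rintro rfl; simp [hp'] at hk
  simpa [Equiv.swap_apply_of_ne_of_ne h h'] using hq hk

theorem IsCompletion.eq_none_of_symm_ne {m : ℕ} {C : Type*} {r : Fin m → Option C}
    {q q' : Fin m ≃ C} (hq : IsCompletion r q) (hq' : IsCompletion r q') {a : C}
    (h : q'.symm a ≠ q.symm a) : r (q.symm a) = none := by
  cases hk : r (q.symm a) with
  | none => rfl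
  | some b =>
    have hb : a = b := by simpa using hq hk
    subst hb
    exact absurd (q'.symm_apply_eq.2 (hq' hk).symm) h

/-- Two distinct candidates can be placed optimally at the same time: the first at a position
of least available weight, the second at a position of greatest available weight. -/
theorem IsPartialRow.exists_isCompletion_min_max {m : ℕ} {C : Type*} [Fintype C]
    (hC : Fintype.card C = m) (wt : Fin m → ℝ) {r : Fin m → Option C} (hr : IsPartialRow r)
    {w c : C} (hwc : w ≠ c) :
    ∃ q : Fin m ≃ C, IsCompletion r q ∧ ∀ q' : Fin m ≃ C, IsCompletion r q' →
      wt (q.symm w) ≤ wt (q'.symm w) ∧ wt (q'.symm c) ≤ wt (q.symm c) := by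
  classical
  have : Nonempty C := ⟨w⟩
  obtain ⟨q, hq, hmin⟩ := Set.exists_min_image {q : Fin m ≃ C | IsCompletion r q}
    (fun q => wt (q.symm w) - wt (q.symm c)) (Set.toFinite _) (hr.exists_isCompletion hC)
  refine ⟨q, hq, fun q' hq' => ⟨?_, ?_⟩⟩
  · by_contra! hlt
    have hne : q'.symm w ≠ q.symm w := fun h => by simp [h] at hlt
    have h := hmin _ (hq.swap_trans (hq.eq_none_of_symm_ne hq' hne)
      (hq'.eq_none_of_symm_ne hq hne.symm))
    have hcw : q.symm c ≠ q.symm w := fun h => hwc (q.symm.injective h).symm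
    simp only [Equiv.symm_trans_apply, Equiv.symm_swap, Equiv.swap_apply_left] at h
    by_cases hc : q.symm c = q'.symm w
    · rw [hc, Equiv.swap_apply_right] at h
      linarith
    · rw [Equiv.swap_apply_of_ne_of_ne hcw hc] at h
      linarith
  · by_contra! hlt
    have hne : q'.symm c ≠ q.symm c := fun h => by simp [h] at hlt
    have h := hmin _ (hq.swap_trans (hq.eq_none_of_symm_ne hq' hne)
      (hq'.eq_none_of_symm_ne hq hne.symm))
    have hcw : q.symm w ≠ q.symm c := fun h => hwc (q.symm.injective h)
    simp only [Equiv.symm_trans_apply, Equiv.symm_swap, Equiv.swap_apply_left] at h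
    by_cases hw : q.symm w = q'.symm c
    · rw [hw, Equiv.swap_apply_right] at h
      linarith
    · rw [Equiv.swap_apply_of_ne_of_ne hcw hw] at h
      linarith

/- STATEMENT 3 -/
theorem stmt3 {n m : ℕ} {C : Type*} [Fintype C] [DecidableEq C]
    (hn : 1 ≤ n) (hm : 2 ≤ m) (hC : Fintype.card C = m)
    (wt : Fin m → ℝ)
    (R : Fin n → Fin m → Option C) (hR : IsPartialMat R)
    (w c : C) (hwc : w ≠ c) :
    ∃ Q : Fin n → Fin m ≃ C, IsMatCompletion R Q ∧
      scoreW wt Q w = matSMinW wt R w ∧ scoreW wt Q c = matSMaxW wt R c := by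
  choose Q hQ hopt using fun i => (hR i).exists_isCompletion_min_max hC wt hwc
  refine ⟨Q, hQ, ?_, ?_⟩
  · have h : IsLeast {x : ℝ | ∃ Q, IsMatCompletion R Q ∧ scoreW wt Q w = x} (scoreW wt Q w) := by
      refine ⟨⟨Q, hQ, rfl⟩, ?_⟩
      rintro _ ⟨Q', hQ', rfl⟩
      exact Finset.sum_le_sum fun i _ => (hopt i (Q' i) (hQ' i)).1
    exact h.csInf_eq.symm
  · have h : IsGreatest {x : ℝ | ∃ Q, IsMatCompletion R Q ∧ scoreW wt Q c = x}
        (scoreW wt Q c) := by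
      refine ⟨⟨Q, hQ, rfl⟩, ?_⟩
      rintro _ ⟨Q', hQ', rfl⟩
      exact Finset.sum_le_sum fun i _ => (hopt i (Q' i) (hQ' i)).2
    exact h.csSup_eq.symm
end

section
/- Let R_i be any partial row over m candidates with |R_i| ≥ 1 entries locked, and w any candidate. Then the total score margin of w under Borda satisfies Δ(R_i) ≤ (m − 1)·(m·|R_i| − (m − 1)). -/
section RowMargin

variable {m : ℕ} {C : Type*}

theorem bordaRowScore_nonneg (q : Fin m ≃ C) (c : C) : 0 ≤ bordaRowScore q c := by
  have := (q.symm c).isLt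
  unfold bordaRowScore
  omega

theorem bordaRowScore_le (q : Fin m ≃ C) (c : C) : bordaRowScore q c ≤ (m : ℤ) - 1 := by
  unfold bordaRowScore
  omega

theorem rowSMin_le {r : Fin m → Option C} {q : Fin m ≃ C} (hq : IsCompletion r q) (c : C) :
    rowSMin r c ≤ bordaRowScore q c :=
  csInf_le ⟨0, by rintro x ⟨q', -, rfl⟩; exact bordaRowScore_nonneg q' c⟩ ⟨q, hq, rfl⟩

theorem le_rowSMax {r : Fin m → Option C} {q : Fin m ≃ C} (hq : IsCompletion r q) (c : C) :
    bordaRowScore q c ≤ rowSMax r c :=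
  le_csSup ⟨(m : ℤ) - 1, by rintro x ⟨q', -, rfl⟩; exact bordaRowScore_le q' c⟩ ⟨q, hq, rfl⟩

/-- Every margin is at most `m - 1` (even when the row has no completion). -/
theorem rowSMin_sub_rowSMax_le (hm : 1 ≤ m) (r : Fin m → Option C) (w c : C) :
    rowSMin r w - rowSMax r c ≤ (m : ℤ) - 1 := by
  by_cases h : ∃ q : Fin m ≃ C, IsCompletion r q
  · obtain ⟨q, hq⟩ := h
    linarith [rowSMin_le hq w, le_rowSMax hq c, bordaRowScore_le q w, bordaRowScore_nonneg q c]
  · have h' : ∀ d : C,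
        {x : ℤ | ∃ q : Fin m ≃ C, IsCompletion r q ∧ bordaRowScore q d = x} = ∅ := by
      intro d
      ext x
      simp only [Set.mem_ofPred_eq, Set.mem_empty_iff_false, iff_false]
      rintro ⟨q, hq, -⟩
      exact h ⟨q, hq⟩
    simp only [rowSMin, rowSMax, h', Int.csInf_empty, Int.csSup_empty]
    omega

theorem exists_equiv_apply_eq_apply_eq [DecidableEq C] (e : Fin m ≃ C) {k p : Fin m} {d c : C}
    (hkp : k ≠ p) (hdc : d ≠ c) : ∃ q : Fin m ≃ C, q k = d ∧ q p = c := by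
  let f := e.trans (Equiv.swap (e k) d)
  have hf : f k = d := by simp [f]
  refine ⟨f.trans (Equiv.swap (f p) c), ?_, by simp⟩
  have h : d ≠ f p := fun h => hkp (f.injective (hf.trans h))
  simp [hf, Equiv.swap_apply_of_ne_of_ne h hdc]

/-- If only one entry is locked, every margin is at most `1`. -/
theorem rowSMin_sub_rowSMax_le_one [DecidableEq C] (hm : 2 ≤ m) (e : Fin m ≃ C)
    {r : Fin m → Option C} {k : Fin m} {d : C} (hk : r k = some d)
    (hr : ∀ j, j ≠ k → r j = none) {w c : C} (hwc : c ≠ w) :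
    rowSMin r w - rowSMax r c ≤ 1 := by
  have hcomp : ∀ q : Fin m ≃ C, q k = d → IsCompletion r q := by
    intro q hq j a hj
    by_cases hjk : j = k
    · subst hjk
      rw [hk] at hj
      exact hq.trans (Option.some.inj hj)
    · rw [hr j hjk] at hj
      cases hj
  by_cases hdw : d = w
  · obtain ⟨p, hp, hp1⟩ : ∃ p : Fin m, k ≠ p ∧ (p : ℕ) ≤ 1 := by
      by_cases h0 : (k : ℕ) = 0
      · exact ⟨⟨1, by omega⟩, fun h => by simp [h] at h0, le_rfl⟩
      · exact ⟨⟨0, by omega⟩, fun h => h0 (by simp [h]), zero_le_one⟩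
    obtain ⟨q, hqk, hqp⟩ := exists_equiv_apply_eq_apply_eq e hp (hdw.trans_ne hwc.symm)
    have h1 := rowSMin_le (hcomp q hqk) w
    have h2 := le_rowSMax (hcomp q hqk) c
    have h3 := bordaRowScore_le q w
    have h4 : bordaRowScore q c = (m : ℤ) - 1 - ((p : ℕ) : ℤ) := by
      rw [bordaRowScore, ← hqp, Equiv.symm_apply_apply]
    omega
  · obtain ⟨p, hp, hp1⟩ : ∃ p : Fin m, k ≠ p ∧ m ≤ (p : ℕ) + 2 := by
      by_cases h0 : (k : ℕ) = m - 1
      · exact ⟨⟨m - 2, by omega⟩, fun h => by simp [h] at h0; omega, by simp; omega⟩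
      · exact ⟨⟨m - 1, by omega⟩, fun h => h0 (by simp [h]), by simp; omega⟩
    obtain ⟨q, hqk, hqp⟩ := exists_equiv_apply_eq_apply_eq e hp hdw
    have h1 := rowSMin_le (hcomp q hqk) w
    have h2 := le_rowSMax (hcomp q hqk) c
    have h3 := bordaRowScore_nonneg q c
    have h4 : bordaRowScore q w = (m : ℤ) - 1 - ((p : ℕ) : ℤ) := by
      rw [bordaRowScore, ← hqp, Equiv.symm_apply_apply]
    omega

theorem rowDelta_le [Fintype C] [DecidableEq C] (hm : 1 ≤ m) (hC : Fintype.card C = m)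
    {r : Fin m → Option C} {w : C} {b : ℤ}
    (h : ∀ c, c ≠ w → rowSMin r w - rowSMax r c ≤ b) : rowDelta r w ≤ ((m : ℤ) - 1) * b := by
  have hcard : (Finset.univ.filter (fun c : C => c ≠ w)).card = m - 1 := by
    rw [Finset.filter_ne', Finset.card_erase_of_mem (Finset.mem_univ w), Finset.card_univ, hC]
  have := Finset.sum_le_card_nsmul (Finset.univ.filter (fun c : C => c ≠ w))
    (fun c => rowSMin r w - rowSMax r c) b (fun c hc => h c (Finset.mem_filter.mp hc).2)
  rw [hcard, nsmul_eq_mul, Nat.cast_sub hm, Nat.cast_one] at this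
  exact this

end RowMargin

/- STATEMENT 14 -/
theorem stmt14 {m : ℕ} {C : Type*} [Fintype C] [DecidableEq C]
    (hm : 2 ≤ m) (hC : Fintype.card C = m)
    (r : Fin m → Option C) (hr : IsPartialRow r) (w : C)
    (hsize : 1 ≤ rowSize r) :
    rowDelta r w ≤ ((m : ℤ) - 1) * ((m : ℤ) * (rowSize r : ℤ) - ((m : ℤ) - 1)) := by
  rcases hsize.eq_or_lt with h1 | h2
  · obtain ⟨k, hk⟩ := Finset.card_eq_one.mp h1.symm
    have hmem : ∀ j, (r j).isSome ↔ j = k := fun j => by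
      simpa using Finset.ext_iff.mp hk j
    obtain ⟨d, hd⟩ := Option.isSome_iff_exists.mp ((hmem k).mpr rfl)
    have hnone : ∀ j, j ≠ k → r j = none := fun j hj => by
      simpa using mt (hmem j).mp hj
    have := rowDelta_le (by omega) hC fun c hc =>
      rowSMin_sub_rowSMax_le_one hm (Fintype.equivFinOfCardEq hC).symm hd hnone (w := w) hc
    rw [← h1]
    push_cast
    linarith
  · refine (rowDelta_le (by omega) hC fun c _ =>
      rowSMin_sub_rowSMax_le (by omega) r w c).trans ?_
    have hm' : (2 : ℤ) ≤ m := by exact_mod_cast hm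
    have h2' : (2 : ℤ) ≤ rowSize r := by exact_mod_cast h2
    refine mul_le_mul_of_nonneg_left ?_ (by linarith)
    nlinarith
end
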